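/- arXiv:2507.05131 — 2 statements merged into one kernel-verified Lean document; each statement's English description precedes it below -/
import Mathlib

section
/- Grassmann Gaussian integral: for an m×m real matrix C and Grassmann generators ψ_1, ψ̄_1, ..., ψ_m, ψ̄_m (anticommuting with ψ_i² = ψ̄_i² = 0), the Berezin integral ∫ ∂ψ_1 ∂ψ̄_1 ⋯ ∂ψ_m ∂ψ̄_m exp(ψ̄^T C ψ) equals det(C). -/
open scoped BigOperators Classical

lemma gr_add_pow {A : Type*} [Ring A] (a s : A) (h : a * s = s * a) (ha : a * a = 0) (n : ℕ) :
    (a + s) ^ (n + 1) = s ^ (n + 1) + (n + 1) • (a * s ^ n) := by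
  induction n with
  | zero => simp [add_comm]
  | succ n ih =>
    rw [pow_succ' (a + s), ih]
    have h2 : s * (a * s ^ n) = a * s ^ (n + 1) := by
      rw [← mul_assoc, ← h, mul_assoc, ← pow_succ']
    have h3 : a * (a * s ^ n) = 0 := by rw [← mul_assoc, ha, zero_mul]
    rw [add_mul, mul_add, mul_add, mul_smul_comm, mul_smul_comm, h2, h3, smul_zero,
      ← pow_succ' s, succ_nsmul (a * s ^ (n + 1)) (n + 1)]
    abel

lemma gr_list_pow {A : Type*} [Ring A] (L : List A)
    (hc : ∀ a ∈ L, ∀ b ∈ L, a * b = b * a) (hs : ∀ a ∈ L, a * a = 0) :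
    L.sum ^ L.length = L.length.factorial • L.prod ∧ L.sum ^ (L.length + 1) = 0 := by
  induction L with
  | nil => simp
  | cons a L ih =>
    obtain ⟨h1, h2⟩ := ih (fun x hx y hy => hc x (by simp [hx]) y (by simp [hy]))
      (fun x hx => hs x (by simp [hx]))
    have hcs : a * L.sum = L.sum * a := by
      have : Commute a L.sum := by
        apply Commute.list_sum_right
        intro b hb
        exact hc a (by simp) b (by simp [hb])
      exact this
    have ha := hs a (by simp)
    constructor
    · rw [List.length_cons, List.sum_cons, gr_add_pow a _ hcs ha, h2, h1, zero_add, mul_smul_comm,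
        smul_smul, List.prod_cons, Nat.factorial_succ]
    · rw [List.length_cons, List.sum_cons, gr_add_pow a _ hcs ha, h2, pow_succ, h2]
      simp

lemma gr_anti_list {A : Type*} [Ring A] (x : A) (n : ℕ) (b : Fin n → A)
    (h : ∀ i, x * b i = -(b i * x)) :
    x * (List.ofFn b).prod = (-1) ^ n * ((List.ofFn b).prod * x) := by
  induction n with
  | zero => simp
  | succ n ih =>
    rw [List.ofFn_succ, List.prod_cons, ← mul_assoc, h 0, neg_mul, mul_assoc,
      ih (fun i => b i.succ) (fun i => h i.succ), pow_succ]
    have hc : b 0 * (-1 : A) ^ n = (-1) ^ n * b 0 :=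
      ((Commute.neg_one_right (b 0)).pow_right n)
    rw [← mul_assoc, hc]
    simp [mul_assoc]

lemma gr_sep {A : Type*} [Ring A] (n : ℕ) : ∃ ε : ℕ, ∀ b e : Fin n → A,
    (∀ i j, e i * b j = -(b j * e i)) →
    (List.ofFn fun i => b i * e i).prod
      = (-1) ^ ε * ((List.ofFn b).prod * (List.ofFn e).prod) := by
  induction n with
  | zero => exact ⟨0, by simp⟩
  | succ n ih =>
    obtain ⟨ε, hε⟩ := ih
    refine ⟨ε + n, fun b e h => ?_⟩
    rw [List.ofFn_succ, List.prod_cons,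
      hε (fun i => b i.succ) (fun i => e i.succ) (fun i j => h _ _),
      List.ofFn_succ, List.prod_cons, List.ofFn_succ (f := e), List.prod_cons]
    have h1 := gr_anti_list (e 0) n (fun i => b i.succ) (fun i => h 0 i.succ)
    have hc : ∀ (y : A) k, y * (-1 : A) ^ k = (-1) ^ k * y :=
      fun y k => ((Commute.neg_one_right y).pow_right k)
    generalize (List.ofFn fun i => b i.succ).prod = P at *
    generalize (List.ofFn fun i => e i.succ).prod = Q at *
    calc b 0 * e 0 * ((-1) ^ ε * (P * Q)) = (b 0 * e 0 * (-1) ^ ε) * (P * Q) := by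
          simp only [mul_assoc]
      _ = (-1) ^ ε * (b 0 * (e 0 * P) * Q) := by rw [hc]; simp only [mul_assoc]
      _ = (-1) ^ ε * ((b 0 * (-1) ^ n) * (P * e 0) * Q) := by rw [h1]; simp only [mul_assoc]
      _ = _ := by rw [hc, pow_add]; simp only [mul_assoc]

lemma gr_low {m : ℕ} {A : Type*} [Ring A] [Algebra ℝ A]
    (ψ ψb : Fin m → A) (B : A →ₗ[ℝ] ℝ)
    (hB0 : ∀ l : List (Fin m ⊕ Fin m), (∃ s, s ∉ l) →
      B (l.map (Sum.elim ψ ψb)).prod = 0)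
    (C : Matrix (Fin m) (Fin m) ℝ) (k : ℕ) : ∀ l : List (Fin m ⊕ Fin m),
    l.length + 2 * k < 2 * m →
    B ((l.map (Sum.elim ψ ψb)).prod * (∑ i, ∑ j, C i j • (ψb i * ψ j)) ^ k) = 0 := by
  induction k with
  | zero =>
    intro l hl
    rw [pow_zero, mul_one]
    apply hB0
    by_contra! hcon
    have h1 : l.toFinset = Finset.univ := by ext s; simp [hcon s]
    have h2 := List.toFinset_card_le l
    rw [h1] at h2
    simp at h2
    omega
  | succ k ih =>
    intro l hl
    rw [pow_succ', ← mul_assoc, Finset.mul_sum, Finset.sum_mul, map_sum]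
    refine Finset.sum_eq_zero fun i _ => ?_
    rw [Finset.mul_sum, Finset.sum_mul, map_sum]
    refine Finset.sum_eq_zero fun j _ => ?_
    have := ih (l ++ [Sum.inr i, Sum.inl j]) (by simp; omega)
    rw [mul_smul_comm, smul_mul_assoc, map_smul]
    simp at this
    simp [this]

/-- **Grassmann Gaussian integral**: let `A` be an `ℝ`-algebra containing
Grassmann generators `ψ i, ψ̄ i` (`i < m`), all pairs anticommuting and squaring
to zero, and let `B` be the Berezin integral, i.e. a linear functional that
vanishes on every monomial in the generators missing some generator and is
normalized by `B(ψ̄ 1 ψ 1 ⋯ ψ̄ m ψ m) = 1` (the convention corresponding to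
`∫ ∂ψ_1 ∂ψ̄_1 ⋯ ∂ψ_m ∂ψ̄_m`). Then the Berezin integral of
`exp(ψ̄ᵀ C ψ)` (a terminating power series) equals `det C`. -/
theorem berezin_integral_exp_eq_det {m : ℕ} {A : Type*} [Ring A] [Algebra ℝ A]
    (ψ ψb : Fin m → A)
    (hanti : ∀ s t : Fin m ⊕ Fin m,
      Sum.elim ψ ψb s * Sum.elim ψ ψb t = -(Sum.elim ψ ψb t * Sum.elim ψ ψb s))
    (hsq : ∀ s : Fin m ⊕ Fin m, Sum.elim ψ ψb s * Sum.elim ψ ψb s = 0)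
    (B : A →ₗ[ℝ] ℝ)
    (hB0 : ∀ l : List (Fin m ⊕ Fin m), (∃ s, s ∉ l) →
      B (l.map (Sum.elim ψ ψb)).prod = 0)
    (hBtop : B (List.ofFn fun i : Fin m => ψb i * ψ i).prod = 1)
    (C : Matrix (Fin m) (Fin m) ℝ) :
    B (∑ k ∈ Finset.range (m + 1),
        (k.factorial : ℝ)⁻¹ • (∑ i, ∑ j, C i j • (ψb i * ψ j)) ^ k) = C.det := by
  have hpp : ∀ i j, ψ i * ψ j = -(ψ j * ψ i) := fun i j => hanti (.inl i) (.inl j)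
  have hpb : ∀ i j, ψ i * ψb j = -(ψb j * ψ i) := fun i j => hanti (.inl i) (.inr j)
  have hbb : ∀ i j, ψb i * ψb j = -(ψb j * ψb i) := fun i j => hanti (.inr i) (.inr j)
  have hb2 : ∀ i, ψb i * ψb i = 0 := fun i => hsq (.inr i)
  let L : (Fin m → ℝ) →ₗ[ℝ] A := Fintype.linearCombination ℝ ψ
  have hL : ∀ v, L v = ∑ j, v j • ψ j := fun v => Fintype.linearCombination_apply ℝ ψ v
  have hLp : ∀ v j, L v * ψ j = -(ψ j * L v) := by
    intro v j
    rw [hL, Finset.sum_mul, Finset.mul_sum, ← Finset.sum_neg_distrib]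
    refine Finset.sum_congr rfl fun i _ => ?_
    rw [smul_mul_assoc, mul_smul_comm, hpp, smul_neg]
  have hLL : ∀ v w, L v * L w = -(L w * L v) := by
    intro v w
    rw [hL w, Finset.sum_mul, Finset.mul_sum, ← Finset.sum_neg_distrib]
    refine Finset.sum_congr rfl fun i _ => ?_
    rw [smul_mul_assoc, mul_smul_comm, hLp, smul_neg]
  have hLb : ∀ v j, L v * ψb j = -(ψb j * L v) := by
    intro v j
    rw [hL, Finset.sum_mul, Finset.mul_sum, ← Finset.sum_neg_distrib]
    refine Finset.sum_congr rfl fun i _ => ?_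
    rw [smul_mul_assoc, mul_smul_comm, hpb, smul_neg]
  have hL2 : ∀ v, L v * L v = 0 := by
    intro v
    have h := hLL v v
    have h2 : (2 : ℝ) • (L v * L v) = 0 := by
      rw [two_smul]; nth_rewrite 1 [h]; simp
    exact (smul_eq_zero_iff_right (two_ne_zero)).1 h2
  let φ : ExteriorAlgebra ℝ (Fin m → ℝ) →ₐ[ℝ] A := ExteriorAlgebra.lift ℝ ⟨L, hL2⟩
  have hφ : ∀ v, φ (ExteriorAlgebra.ι ℝ v) = L v := fun v => ExteriorAlgebra.lift_ι_apply ℝ L hL2 v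
  have hφm : ∀ v : Fin m → Fin m → ℝ,
      φ (ExteriorAlgebra.ιMulti ℝ m v) = (List.ofFn fun i => L (v i)).prod := by
    intro v
    rw [ExteriorAlgebra.ιMulti_apply, map_list_prod, List.map_ofFn]
    congr 2
    funext i
    exact hφ _
  obtain ⟨ε, hε⟩ := gr_sep (A := A) m
  let G : A →ₗ[ℝ] ℝ := B ∘ₗ LinearMap.mulLeft ℝ ((-1) ^ ε * (List.ofFn ψb).prod)
  let f : (Fin m → ℝ) [⋀^Fin m]→ₗ[ℝ] ℝ :=
    (G ∘ₗ φ.toLinearMap).compAlternatingMap (ExteriorAlgebra.ιMulti ℝ m)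
  have hf : ∀ v : Fin m → Fin m → ℝ, f v = B (List.ofFn fun i => ψb i * L (v i)).prod := by
    intro v
    rw [hε ψb (fun i => L (v i)) (fun i j => hLb _ _), ← hφm, ← mul_assoc]
    rfl
  have hfe : f (Pi.basisFun ℝ (Fin m)) = 1 := by
    rw [hf, ← hBtop]
    congr 4
    funext i
    rw [hL]
    simp [Pi.single_apply]
  have hdet : f C = C.det := by
    rw [AlternatingMap.eq_smul_basis_det (Pi.basisFun ℝ (Fin m)) f, hfe, one_smul,
      Pi.basisFun_det]
    rfl
  have hS : (∑ i, ∑ j, C i j • (ψb i * ψ j)) = (List.ofFn fun i => ψb i * L (C i)).sum := by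
    rw [List.sum_ofFn]
    refine Finset.sum_congr rfl fun i _ => ?_
    rw [hL, Finset.mul_sum]
    refine Finset.sum_congr rfl fun j _ => ?_
    rw [mul_smul_comm]
  have htop := (gr_list_pow (List.ofFn fun i => ψb i * L (C i)) (by
      intro a ha b hb
      rw [List.mem_ofFn] at ha hb
      obtain ⟨i, rfl⟩ := ha
      obtain ⟨j, rfl⟩ := hb
      calc ψb i * L (C i) * (ψb j * L (C j)) = ψb i * (L (C i) * ψb j) * L (C j) := by
            simp only [mul_assoc]
        _ = -((ψb i * ψb j) * (L (C i) * L (C j))) := by rw [hLb]; simp [mul_assoc]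
        _ = -((ψb j * ψb i) * (L (C j) * L (C i))) := by rw [hbb i j, hLL (C i)]; simp
        _ = ψb j * (-(ψb i * L (C j))) * L (C i) := by simp [mul_assoc]
        _ = _ := by rw [← hLb]; simp only [mul_assoc]) (by
      intro a ha
      rw [List.mem_ofFn] at ha
      obtain ⟨i, rfl⟩ := ha
      calc ψb i * L (C i) * (ψb i * L (C i)) = ψb i * (L (C i) * ψb i) * L (C i) := by
            simp only [mul_assoc]
        _ = -((ψb i * ψb i) * (L (C i) * L (C i))) := by rw [hLb]; simp [mul_assoc]
        _ = 0 := by rw [hb2]; simp)).1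
  rw [← hS, List.length_ofFn] at htop
  have hval : B (List.ofFn fun i => ψb i * L (C i)).prod = C.det := (hf C).symm.trans hdet
  rw [Finset.sum_range_succ, map_add, map_sum, Finset.sum_eq_zero, zero_add, map_smul, htop,
    map_nsmul, hval, nsmul_eq_mul, smul_eq_mul, ← mul_assoc, inv_mul_cancel₀, one_mul]
  · exact_mod_cast Nat.factorial_ne_zero m
  · intro k hk
    have hk' := Finset.mem_range.1 hk
    have := gr_low ψ ψb B hB0 C k [] (by simp; omega)
    rw [List.map_nil, List.prod_nil, one_mul] at this
    rw [map_smul, this, smul_zero]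
end

section
/- Cumulant duality for squares (bosonic vs fermionic): let G be an n×n symmetric positive-definite real matrix, (Z_i) a complex Gaussian vector with covariance G, and ⟨·⟩_{G^{-1}} the fermionic Gaussian state with matrix G^{-1}. Then for every A ⊂ [n], the joint cumulant of (|Z_i|²)_{i∈A} equals (−1)^{|A|−1} times the joint cumulant of (ψ_i ψ̄_i)_{i∈A} under the fermionic state; equivalently, k_{bos(ℂ)}(A) = Σ_{σ cyclic on A} ∏_i G(i,σ(i)) and k_{ferm(ℂ)}(A) = Σ_{σ cyclic on A} sign(σ) ∏_i G(i,σ(i)), and sign(σ) = (−1)^{|A|−1} for cyclic σ. -/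
open MeasureTheory ProbabilityTheory
open scoped BigOperators Classical

/-- A centered complex Gaussian vector: every real linear combination of the
real and imaginary parts is a centered real Gaussian. -/
def IsCenteredComplexGaussianVector {Ω : Type*} [MeasurableSpace Ω]
    (μ : Measure Ω) {n : ℕ} (Z : Fin n → Ω → ℂ) : Prop :=
  ∀ c d : Fin n → ℝ, ∃ v : NNReal,
    Measure.map (fun ω => ∑ i, (c i * (Z i ω).re + d i * (Z i ω).im)) μ =
      gaussianReal 0 v

/-- The set partitions of a finite set `A`. -/
noncomputable def finsetPartitions {n : ℕ} (A : Finset (Fin n)) :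
    Finset (Finset (Finset (Fin n))) :=
  A.powerset.powerset.filter fun π =>
    (∀ B ∈ π, B.Nonempty) ∧ (∀ B ∈ π, ∀ C ∈ π, B ≠ C → Disjoint B C) ∧
      π.sup id = A

/-- Bosonic cumulants: joint cumulants of `(|Z_i|²)_{i∈A}`. -/
noncomputable def kBos {Ω : Type*} [MeasurableSpace Ω] (μ : Measure Ω) {n : ℕ}
    (Z : Fin n → Ω → ℂ) (A : Finset (Fin n)) : ℝ :=
  ∑ π ∈ finsetPartitions A,
    ((π.card - 1).factorial : ℝ) * (-1 : ℝ) ^ (π.card - 1) *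
      ∏ B ∈ π, ∫ ω, ∏ i ∈ B, Complex.normSq (Z i ω) ∂μ

/-- Fermionic cumulants: the joint moments of `(ψ_i ψ̄_i)_{i∈A}` under the
fermionic Gaussian state with matrix `G⁻¹` are `⟨∏_{i∈B} ψ_i ψ̄_i⟩ = det(G_BB)`,
and the cumulants are obtained by the moment-cumulant Möbius formula. -/
noncomputable def kFerm {n : ℕ} (G : Matrix (Fin n) (Fin n) ℝ)
    (A : Finset (Fin n)) : ℝ :=
  ∑ π ∈ finsetPartitions A,
    ((π.card - 1).factorial : ℝ) * (-1 : ℝ) ^ (π.card - 1) *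
      ∏ B ∈ π,
        (G.submatrix (fun a : {x // x ∈ B} => (a : Fin n))
          (fun a : {x // x ∈ B} => (a : Fin n))).det

lemma gaussian_even_moment (v : NNReal) (m : ℕ) :
    ∫ x, x ^ (2 * m) ∂(gaussianReal 0 v) =
      (Nat.doubleFactorial (2 * m - 1) : ℝ) * (v : ℝ) ^ m := by
  by_cases hv : v = 0
  · subst hv
    rcases Nat.eq_zero_or_pos m with rfl | hm
    · simp
    · simp [hm.ne']
  · have hvpos : (0 : ℝ) < v := by
      have := pos_iff_ne_zero.mpr hv
      exact_mod_cast this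
    rw [integral_gaussianReal_eq_integral_smul hv]
    have h1 : ∀ x : ℝ, gaussianPDFReal 0 v x • x ^ (2 * m) =
        (fun y : ℝ => (Real.sqrt (2 * Real.pi * v))⁻¹ *
          (y ^ ((2 * m : ℕ) : ℝ) * Real.exp (-(1 / (2 * (v : ℝ))) * y ^ (2 : ℝ)))) |x| := by
      intro x
      simp only [gaussianPDFReal, smul_eq_mul, Real.rpow_natCast]
      have e1 : |x| ^ (2 : ℝ) = x ^ 2 := by
        rw [show (2 : ℝ) = ((2 : ℕ) : ℝ) by norm_num, Real.rpow_natCast, sq_abs]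
      have e2 : |x| ^ (2 * m) = x ^ (2 * m) := by
        rw [pow_mul, sq_abs, ← pow_mul]
      rw [e1, e2]
      have e3 : -(x - 0) ^ 2 / (2 * (v : ℝ)) = -(1 / (2 * (v : ℝ))) * x ^ 2 := by
        field_simp; ring
      rw [e3]; ring
    simp_rw [h1]
    rw [integral_comp_abs (f := (fun y : ℝ => (Real.sqrt (2 * Real.pi * v))⁻¹ *
          (y ^ ((2 * m : ℕ) : ℝ) * Real.exp (-(1 / (2 * (v : ℝ))) * y ^ (2 : ℝ)))))]
    rw [integral_const_mul, integral_rpow_mul_exp_neg_mul_rpow (by norm_num)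
      (by have : (0 : ℝ) ≤ ((2 * m : ℕ) : ℝ) := by positivity
          linarith) (by positivity)]
    have e4 : (((2 * m : ℕ) : ℝ) + 1) / 2 = m + 1 / 2 := by push_cast; ring
    have e5 : -(((2 * m : ℕ) : ℝ) + 1) / 2 = - (m + 1 / 2) := by push_cast; ring
    rw [e4, e5, Real.Gamma_nat_add_half, one_div (2 * (v : ℝ)), Real.rpow_neg (by positivity),
      Real.inv_rpow (by positivity), inv_inv, Real.rpow_add (by positivity), Real.rpow_natCast,
      ← Real.sqrt_eq_rpow, show 2 * Real.pi * (v : ℝ) = Real.pi * (2 * v) by ring,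
      Real.sqrt_mul Real.pi_pos.le]
    have p1 : Real.sqrt Real.pi ≠ 0 := by positivity
    have p2 : Real.sqrt (2 * (v : ℝ)) ≠ 0 := by positivity
    field_simp
    rw [mul_pow]

lemma doubleFact_mul (m : ℕ) :
    Nat.doubleFactorial (2 * m - 1) * (2 ^ m * m.factorial) = (2 * m).factorial := by
  cases m with
  | zero => simp
  | succ k =>
    rw [← Nat.doubleFactorial_two_mul, show 2 * (k+1) - 1 = 2 * k + 1 by omega,
      show 2 * (k + 1) = (2 * k + 1) + 1 by ring, Nat.factorial_eq_mul_doubleFactorial, mul_comm]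

/-- Polarization, general form. -/
lemma polarization_gen {κ R : Type*} [DecidableEq κ] [CommRing R] (x : κ → R) (S : Finset κ) :
    ∀ (y : R) (k : ℕ), k ≤ S.card →
    ∑ T ∈ S.powerset, (-1 : R) ^ (S \ T).card * (y + ∑ i ∈ T, x i) ^ k =
      if k = S.card then (S.card.factorial : R) * ∏ i ∈ S, x i else 0 := by
  induction S using Finset.induction_on with
  | empty => intro y k hk; simp at hk; subst hk; simp
  | insert a S ha ih =>
    intro y k hk
    rw [Finset.card_insert_of_notMem ha] at hk
    have h1 : ∑ T ∈ (insert a S).powerset,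
        (-1 : R) ^ (insert a S \ T).card * (y + ∑ i ∈ T, x i) ^ k =
        ∑ T ∈ S.powerset, ∑ j ∈ Finset.range k,
          (x a ^ (k - j) * (k.choose j : R)) *
            ((-1 : R) ^ (S \ T).card * (y + ∑ i ∈ T, x i) ^ j) := by
      rw [Finset.sum_powerset_insert ha, ← Finset.sum_add_distrib]
      refine Finset.sum_congr rfl fun T hT => ?_
      rw [Finset.mem_powerset] at hT
      have haT : a ∉ T := fun h => ha (hT h)
      rw [Finset.insert_sdiff_of_notMem _ haT, Finset.card_insert_of_notMem (by simp [ha]),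
        Finset.sum_insert haT, Finset.insert_sdiff_insert, Finset.sdiff_insert_of_notMem ha]
      have := add_pow (y + ∑ i ∈ T, x i) (x a) k
      rw [Finset.sum_range_succ] at this
      simp only [Nat.sub_self, pow_zero, Nat.choose_self, Nat.cast_one, mul_one] at this
      rw [show y + (x a + ∑ i ∈ T, x i) = (y + ∑ i ∈ T, x i) + x a by ring, this, mul_add,
        Finset.mul_sum, pow_succ]
      have : ∀ A B C : R, A * -1 * B + (C + A * B) = C := by intros; ring
      rw [this]
      refine Finset.sum_congr rfl fun j _ => by ring
    rw [h1, Finset.sum_comm]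
    simp_rw [← Finset.mul_sum]
    rw [Finset.sum_congr rfl (fun j hj => by
      rw [ih y j (by have := Finset.mem_range.mp hj; omega)])]
    rw [Finset.card_insert_of_notMem ha, Finset.prod_insert ha]
    split_ifs with h
    · subst h
      rw [Finset.sum_range_succ, Finset.sum_eq_zero]
      · simp [Nat.factorial_succ]; ring
      · intro j hj
        have := Finset.mem_range.mp hj
        rw [if_neg (by omega)]; simp
    · apply Finset.sum_eq_zero
      intro j hj
      have := Finset.mem_range.mp hj
      rw [if_neg (by omega)]; simp

lemma polarization {κ R : Type*} [Fintype κ] [DecidableEq κ] [CommRing R] (x : κ → R) :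
    ∑ T : Finset κ, (-1 : R) ^ Tᶜ.card * (∑ i ∈ T, x i) ^ (Fintype.card κ) =
      ((Fintype.card κ).factorial : R) * ∏ i, x i := by
  have := polarization_gen x Finset.univ 0 (Fintype.card κ) le_rfl
  simpa [Finset.compl_eq_univ_sdiff] using this

lemma ryser {ι R : Type*} [Fintype ι] [DecidableEq ι] [CommRing R] (M : ι → ι → R) :
    ∑ T : Finset ι, (-1 : R) ^ Tᶜ.card * ∏ i, ∑ j ∈ T, M i j =
      ∑ σ : Equiv.Perm ι, ∏ i, M i (σ i) := by
  have h1 : ∀ T : Finset ι, (-1 : R) ^ Tᶜ.card * ∏ i, ∑ j ∈ T, M i j =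
      ∑ f : ι → ι, (∏ i, M i (f i)) *
        ∏ j ∈ Tᶜ, (if j ∈ Set.range f then (0 : R) else -1) := by
    intro T
    have : ∀ i, ∑ j ∈ T, M i j = ∑ j, if j ∈ T then M i j else 0 := by
      intro i; simp
    simp_rw [this]
    rw [Finset.prod_univ_sum, Finset.mul_sum]
    simp only [Fintype.piFinset_univ]
    refine Finset.sum_congr rfl fun f _ => ?_
    by_cases hf : ∀ i, f i ∈ T
    · rw [Finset.prod_congr rfl (fun i _ => if_pos (hf i)), mul_comm]
      congr 1
      rw [← Finset.prod_const]
      refine Finset.prod_congr rfl fun j hj => ?_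
      rw [if_neg]
      rintro ⟨i, rfl⟩
      exact (Finset.mem_compl.mp hj) (hf i)
    · push Not at hf
      obtain ⟨i, hi⟩ := hf
      rw [Finset.prod_eq_zero (Finset.mem_univ i) (if_neg hi),
        Finset.prod_eq_zero (s := Tᶜ) (i := f i)
          (f := fun j => if j ∈ Set.range f then (0 : R) else -1)
          (Finset.mem_compl.mpr hi) (if_pos (Set.mem_range_self i))]
      simp
  simp_rw [h1]
  rw [Finset.sum_comm]
  simp_rw [← Finset.mul_sum]
  have h2 : ∀ f : ι → ι, ∑ T : Finset ι, ∏ j ∈ Tᶜ, (if j ∈ Set.range f then (0 : R) else -1) =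
      if Function.Bijective f then 1 else 0 := by
    intro f
    have := Finset.prod_add (fun _ : ι => (1 : R))
      (fun j => if j ∈ Set.range f then (0 : R) else -1) Finset.univ
    simp only [Finset.prod_const_one, one_mul, Finset.powerset_univ,
      ← Finset.compl_eq_univ_sdiff] at this
    rw [← this]
    split_ifs with h
    · apply Finset.prod_eq_one
      intro j _
      rw [if_pos (show j ∈ Set.range f from h.2 j)]; simp
    · rw [← Finite.surjective_iff_bijective] at h
      simp only [Function.Surjective, not_forall] at h
      obtain ⟨j, hj⟩ := h
      apply Finset.prod_eq_zero (Finset.mem_univ j)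
      rw [if_neg (by simpa using hj)]; simp
  simp_rw [h2]
  simp only [mul_ite, mul_one, mul_zero]
  rw [← Finset.sum_filter]
  symm
  refine Finset.sum_bij (fun σ _ => (σ : ι → ι)) ?_ ?_ ?_ ?_
  · intro σ _; simp
  · intro σ _ τ _ h; exact DFunLike.coe_injective h
  · intro f hf
    exact ⟨Equiv.ofBijective f (Finset.mem_filter.mp hf).2, Finset.mem_univ _, rfl⟩
  · intro σ _; rfl

/-- All moments finite. -/
def AllLp {Ω : Type*} [MeasurableSpace Ω] (μ : Measure Ω) (f : Ω → ℂ) : Prop :=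
  ∀ p : ENNReal, p ≠ ⊤ → MemLp f p μ

lemma AllLp.mul {Ω : Type*} [MeasurableSpace Ω] {μ : Measure Ω} {f g : Ω → ℂ}
    (hf : AllLp μ f) (hg : AllLp μ g) : AllLp μ (fun ω => f ω * g ω) := by
  intro p hp
  have h2 : (2 * p) ≠ ⊤ := ENNReal.mul_ne_top (by simp) hp
  have : ENNReal.HolderTriple (2 * p) (2 * p) p := ⟨by
    rw [ENNReal.mul_inv (by simp) (by simp), ← add_mul, ENNReal.inv_two_add_inv_two, one_mul]⟩
  exact MemLp.mul (hg _ h2) (hf _ h2)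

lemma AllLp.const {Ω : Type*} [MeasurableSpace Ω] {μ : Measure Ω} [IsProbabilityMeasure μ]
    (c : ℂ) : AllLp μ (fun _ => c) := fun p _ => memLp_const c

lemma AllLp.pow {Ω : Type*} [MeasurableSpace Ω] {μ : Measure Ω} [IsProbabilityMeasure μ]
    {f : Ω → ℂ} (hf : AllLp μ f) (n : ℕ) : AllLp μ (fun ω => f ω ^ n) := by
  induction n with
  | zero => simpa using AllLp.const 1
  | succ n ih => simpa [pow_succ] using ih.mul hf

lemma AllLp.prod {Ω κ : Type*} [MeasurableSpace Ω] {μ : Measure Ω} [IsProbabilityMeasure μ]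
    {f : κ → Ω → ℂ} (hf : ∀ k, AllLp μ (f k)) (S : Finset κ) :
    AllLp μ (fun ω => ∏ k ∈ S, f k ω) := by
  induction S using Finset.induction_on with
  | empty => simpa using AllLp.const 1
  | insert a S ha ih => simpa [Finset.prod_insert ha] using (hf a).mul ih

lemma AllLp.sum {Ω κ : Type*} [MeasurableSpace Ω] {μ : Measure Ω}
    {f : κ → Ω → ℂ} (hf : ∀ k, AllLp μ (f k)) (S : Finset κ) :
    AllLp μ (fun ω => ∑ k ∈ S, f k ω) := by
  intro p hp
  exact memLp_finsetSum S fun i _ => hf i p hp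

lemma AllLp.integrable {Ω : Type*} [MeasurableSpace Ω] {μ : Measure Ω}
    {f : Ω → ℂ} (hf : AllLp μ f) : Integrable f μ :=
  memLp_one_iff_integrable.mp (hf 1 (by simp))

lemma allLp_of_gaussian {Ω : Type*} [MeasurableSpace Ω] {μ : Measure Ω}
    {X : Ω → ℝ} (hX : Measurable X) {v : NNReal} (h : μ.map X = gaussianReal 0 v) :
    AllLp μ (fun ω => (X ω : ℂ)) := by
  intro p hp
  have h1 := memLp_id_gaussianReal' (μ := 0) (v := v) p hp
  rw [← h] at h1
  exact (h1.comp_of_map hX.aemeasurable).ofReal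

lemma moment_poly {Ω : Type*} [MeasurableSpace Ω] {μ : Measure Ω} [IsProbabilityMeasure μ]
    {X Y : Ω → ℂ} (hX : AllLp μ X) (hY : AllLp μ Y) (N : ℕ) :
    ∃ P : Polynomial ℂ, ∀ z : ℂ, ∫ ω, (X ω + z * Y ω) ^ N ∂μ = P.eval z := by
  refine ⟨∑ k ∈ Finset.range (N + 1),
    Polynomial.C ((∫ ω, X ω ^ k * Y ω ^ (N - k) ∂μ) * (N.choose k : ℂ)) *
      Polynomial.X ^ (N - k), fun z => ?_⟩
  simp only [Polynomial.eval_finsetSum, Polynomial.eval_mul, Polynomial.eval_C,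
    Polynomial.eval_pow, Polynomial.eval_X, add_pow, mul_pow]
  rw [integral_finsetSum]
  · refine Finset.sum_congr rfl fun k _ => ?_
    rw [← integral_mul_const, ← integral_mul_const]
    congr 1; ext ω; ring
  · intro k _
    refine AllLp.integrable ?_
    exact ((hX.pow _).mul ((AllLp.const _).mul (hY.pow _))).mul (AllLp.const _)

lemma complex_moment {Ω : Type*} [MeasurableSpace Ω] {μ : Measure Ω} [IsProbabilityMeasure μ]
    {X Y : Ω → ℝ} (hmX : Measurable X) (hmY : Measurable Y)
    (hX : AllLp μ (fun ω => (X ω : ℂ))) (hY : AllLp μ (fun ω => (Y ω : ℂ)))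
    (h : ∀ s : ℝ, ∃ v : NNReal, μ.map (fun ω => X ω + s * Y ω) = gaussianReal 0 v) (m : ℕ) (z : ℂ) :
    ∫ ω, ((X ω : ℂ) + z * Y ω) ^ (2 * m) ∂μ =
      (Nat.doubleFactorial (2 * m - 1) : ℂ) * (∫ ω, ((X ω : ℂ) + z * Y ω) ^ 2 ∂μ) ^ m := by
  obtain ⟨P, hP⟩ := moment_poly hX hY (2 * m)
  obtain ⟨Q, hQ⟩ := moment_poly hX hY 2
  have key : P = Polynomial.C (Nat.doubleFactorial (2 * m - 1) : ℂ) * Q ^ m := by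
    apply Polynomial.eq_of_infinite_eval_eq
    refine Set.Infinite.mono ?_ (Set.infinite_range_of_injective Complex.ofReal_injective)
    rintro _ ⟨s, rfl⟩
    simp only [Set.mem_ofPred_eq, Polynomial.eval_mul, Polynomial.eval_C, Polynomial.eval_pow]
    rw [← hP, ← hQ]
    obtain ⟨v, hv⟩ := h s
    have hm : Measurable (fun ω => X ω + s * Y ω) := by fun_prop
    have mom : ∀ k : ℕ, ∫ ω, (X ω + s * Y ω) ^ (2 * k) ∂μ =
        (Nat.doubleFactorial (2 * k - 1) : ℝ) * (v : ℝ) ^ k := by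
      intro k
      rw [← gaussian_even_moment, ← hv, integral_map hm.aemeasurable (by fun_prop)]
    have momc : ∀ N : ℕ, ∫ ω, ((X ω : ℂ) + s * Y ω) ^ N ∂μ =
        ((∫ ω, (X ω + s * Y ω) ^ N ∂μ : ℝ) : ℂ) := by
      intro N
      rw [← integral_complex_ofReal]
      congr 1; ext ω; push_cast; rfl
    have m2 := mom 1
    simp at m2
    rw [momc, momc, mom, m2]
    push_cast; rfl
  rw [hP, key, hQ]
  simp

lemma wick_polar {Ω κ : Type*} [Fintype κ] [DecidableEq κ] [MeasurableSpace Ω] {μ : Measure Ω}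
    [IsProbabilityMeasure μ] (W : κ → Ω → ℂ) (hW : ∀ k, Measurable (W k))
    (hg : ∀ c d : κ → ℝ, ∃ v : NNReal,
      μ.map (fun ω => ∑ k, (c k * (W k ω).re + d k * (W k ω).im)) = gaussianReal 0 v)
    (hL : ∀ k, AllLp μ (W k))
    (m : ℕ) (hm : Fintype.card κ = 2 * m) :
    ((2 * m).factorial : ℂ) * ∫ ω, ∏ k, W k ω ∂μ =
      ∑ U : Finset κ, (-1 : ℂ) ^ Uᶜ.card * ((Nat.doubleFactorial (2 * m - 1) : ℂ) *
        (∑ k ∈ U, ∑ l ∈ U, ∫ ω, W k ω * W l ω ∂μ) ^ m) := by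
  rw [← hm, ← integral_const_mul]
  simp_rw [← polarization]
  rw [integral_finsetSum]
  swap
  · intro U _
    exact ((AllLp.const _).mul ((AllLp.sum hL U).pow _)).integrable
  refine Finset.sum_congr rfl fun U _ => ?_
  rw [integral_const_mul]
  congr 1
  set X : Ω → ℝ := fun ω => ∑ k ∈ U, (W k ω).re with hXd
  set Y : Ω → ℝ := fun ω => ∑ k ∈ U, (W k ω).im with hYd
  have hmX : Measurable X := by
    exact Finset.measurable_sum _ fun k _ => Complex.measurable_re.comp (hW k)
  have hmY : Measurable Y := by
    exact Finset.measurable_sum _ fun k _ => Complex.measurable_im.comp (hW k)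
  have hlin : ∀ r s : ℝ, ∃ v : NNReal, μ.map (fun ω => r * X ω + s * Y ω) = gaussianReal 0 v := by
    intro r s
    obtain ⟨v, hv⟩ := hg (fun k => if k ∈ U then r else 0) (fun k => if k ∈ U then s else 0)
    refine ⟨v, ?_⟩
    rw [← hv]
    congr 1
    ext ω
    simp [hXd, hYd, Finset.mul_sum, Finset.sum_add_distrib]
  have hX : AllLp μ (fun ω => (X ω : ℂ)) := by
    obtain ⟨v, hv⟩ := hlin 1 0
    simp at hv
    exact allLp_of_gaussian hmX hv
  have hY : AllLp μ (fun ω => (Y ω : ℂ)) := by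
    obtain ⟨v, hv⟩ := hlin 0 1
    simp at hv
    exact allLp_of_gaussian hmY hv
  have hsum : ∀ ω, ∑ k ∈ U, W k ω = (X ω : ℂ) + Complex.I * Y ω := by
    intro ω
    simp only [hXd, hYd]
    push_cast
    rw [Finset.mul_sum, ← Finset.sum_add_distrib]
    refine Finset.sum_congr rfl fun k _ => ?_
    rw [mul_comm, Complex.re_add_im]
  have := complex_moment hmX hmY hX hY (fun s => by simpa using hlin 1 s) m Complex.I
  simp_rw [← hsum] at this
  rw [hm, this]
  congr 2
  simp_rw [sq, Finset.sum_mul_sum]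
  rw [integral_finsetSum]
  · refine Finset.sum_congr rfl fun k _ => ?_
    rw [integral_finsetSum]
    exact fun l _ => ((hL k).mul (hL l)).integrable
  · intro k _
    exact (AllLp.sum (fun l => (hL k).mul (hL l)) U).integrable

lemma wick_perm {Ω ι : Type*} [Fintype ι] [DecidableEq ι] [MeasurableSpace Ω] {μ : Measure Ω}
    [IsProbabilityMeasure μ] (Z : ι → Ω → ℂ) (hmZ : ∀ k, Measurable (Z k))
    (hg : ∀ c d : ι → ℝ, ∃ v : NNReal,
      μ.map (fun ω => ∑ k, (c k * (Z k ω).re + d k * (Z k ω).im)) = gaussianReal 0 v)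
    (G : ι → ι → ℝ)
    (hcovZ : ∀ i j, ∫ ω, Z i ω * (starRingEnd ℂ) (Z j ω) ∂μ = (G i j : ℂ))
    (hpseudoZ : ∀ i j, ∫ ω, Z i ω * Z j ω ∂μ = 0) :
    ∫ ω, ∏ i, Complex.normSq (Z i ω) ∂μ = ∑ σ : Equiv.Perm ι, ∏ i, G i (σ i) := by
  set W : ι ⊕ ι → Ω → ℂ := Sum.elim Z (fun i ω => (starRingEnd ℂ) (Z i ω)) with hWd
  have hmW : ∀ k, Measurable (W k) := by
    rintro (k | k)
    · exact hmZ k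
    · exact Complex.continuous_conj.measurable.comp (hmZ k)
  have hgW : ∀ c d : ι ⊕ ι → ℝ, ∃ v : NNReal,
      μ.map (fun ω => ∑ k, (c k * (W k ω).re + d k * (W k ω).im)) = gaussianReal 0 v := by
    intro c d
    obtain ⟨v, hv⟩ := hg (fun i => c (.inl i) + c (.inr i)) (fun i => d (.inl i) - d (.inr i))
    refine ⟨v, ?_⟩
    rw [← hv]
    congr 1
    ext ω
    rw [Fintype.sum_sum_type, ← Finset.sum_add_distrib]
    refine Finset.sum_congr rfl fun k _ => ?_
    simp [hWd]; ring
  have hLW : ∀ k, AllLp μ (W k) := by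
    intro k
    have h1 : AllLp μ (fun ω => ((W k ω).re : ℂ)) := by
      obtain ⟨v, hv⟩ := hgW (fun l => if l = k then 1 else 0) 0
      simp only [ite_mul, one_mul, zero_mul, Pi.zero_apply, add_zero, Finset.sum_ite_eq',
        Finset.mem_univ, if_true] at hv
      exact allLp_of_gaussian (Complex.measurable_re.comp (hmW k)) hv
    have h2 : AllLp μ (fun ω => ((W k ω).im : ℂ)) := by
      obtain ⟨v, hv⟩ := hgW 0 (fun l => if l = k then 1 else 0)
      simp only [ite_mul, one_mul, zero_mul, Pi.zero_apply, zero_add, Finset.sum_ite_eq',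
        Finset.mem_univ, if_true] at hv
      exact allLp_of_gaussian (Complex.measurable_im.comp (hmW k)) hv
    intro p hp
    have := (h1 p hp).add ((h2.mul (μ := μ) (AllLp.const (μ := μ) Complex.I)) p hp)
    refine (memLp_congr_ae (Filter.Eventually.of_forall fun ω => ?_)).mp this
    simp [Complex.re_add_im]
  set m := Fintype.card ι with hm
  have main := wick_polar W hmW hgW hLW m (by simp [hm]; ring)
  have hcovU : ∀ T T' : Finset ι, ∑ k ∈ T.disjSum T', ∑ l ∈ T.disjSum T',
      ∫ ω, W k ω * W l ω ∂μ = 2 * ∑ i ∈ T, ∑ j ∈ T', (G i j : ℂ) := by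
    intro T T'
    have hcc : ∀ i j, ∫ ω, (starRingEnd ℂ) (Z i ω) * (starRingEnd ℂ) (Z j ω) ∂μ = 0 := by
      intro i j
      simp_rw [← map_mul]
      rw [integral_conj, hpseudoZ, map_zero]
    have hcz : ∀ i j, ∫ ω, (starRingEnd ℂ) (Z i ω) * Z j ω ∂μ = (G j i : ℂ) := by
      intro i j
      rw [← hcovZ]
      congr 1; ext ω; ring
    simp only [Finset.sum_disjSum, hWd, Sum.elim_inl, Sum.elim_inr, hcovZ, hpseudoZ, hcc, hcz,
      Finset.sum_const_zero, zero_add, add_zero]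
    rw [Finset.sum_comm (s := T')]
    ring
  rw [← Finset.sumEquiv.symm.toEquiv.sum_comp] at main
  rw [Fintype.sum_prod_type, Finset.sum_comm] at main
  have hterm : ∀ T T' : Finset ι,
      (-1 : ℂ) ^ (Finset.sumEquiv.symm (T, T'))ᶜ.card * ((Nat.doubleFactorial (2 * m - 1) : ℂ) *
        (∑ k ∈ Finset.sumEquiv.symm (T, T'), ∑ l ∈ Finset.sumEquiv.symm (T, T'),
          ∫ ω, W k ω * W l ω ∂μ) ^ m) =
      ((Nat.doubleFactorial (2 * m - 1) : ℂ) * 2 ^ m) * ((-1 : ℂ) ^ T'ᶜ.card *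
        ((-1 : ℂ) ^ Tᶜ.card * (∑ i ∈ T, ∑ j ∈ T', (G i j : ℂ)) ^ m)) := by
    intro T T'
    rw [Finset.sumEquiv_symm_apply, hcovU, mul_pow]
    have : (T.disjSum T')ᶜ.card = Tᶜ.card + T'ᶜ.card := by
      rw [← Finset.card_disjSum]
      congr 1
      ext (a | a) <;> simp
    simp only [this, pow_add]
    ring
  have main2 : ((2 * m).factorial : ℂ) * ∫ ω, ∏ k, W k ω ∂μ =
      ((2 * m).factorial : ℂ) * ∑ σ : Equiv.Perm ι, ∏ i, (G i (σ i) : ℂ) := by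
    rw [main, ← ryser (fun i j => (G i j : ℂ)), ← doubleFact_mul, Finset.mul_sum]
    refine Finset.sum_congr rfl fun T' _ => ?_
    refine (Finset.sum_congr rfl fun T _ => hterm T T').trans ?_
    rw [← Finset.mul_sum, ← Finset.mul_sum, hm, polarization (fun i => ∑ j ∈ T', (G i j : ℂ))]
    push_cast
    ring
  have main3 := mul_left_cancel₀ (by exact_mod_cast (2 * m).factorial_ne_zero) main2
  have : ∀ ω, ∏ k, W k ω = ((∏ i, Complex.normSq (Z i ω) : ℝ) : ℂ) := by
    intro ω
    rw [Fintype.prod_sum_type, ← Finset.prod_mul_distrib]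
    push_cast
    refine Finset.prod_congr rfl fun i _ => ?_
    simp only [hWd, Sum.elim_inl, Sum.elim_inr, Complex.mul_conj]
  simp_rw [this] at main3
  rw [integral_complex_ofReal] at main3
  exact_mod_cast main3

lemma mem_parts {n : ℕ} {A : Finset (Fin n)} {π : Finset (Finset (Fin n))} :
    π ∈ finsetPartitions A ↔ (∀ B ∈ π, B.Nonempty) ∧
      (∀ B ∈ π, ∀ C ∈ π, B ≠ C → Disjoint B C) ∧ (∀ x, x ∈ A ↔ ∃ B ∈ π, x ∈ B) := by
  have hsup : π.sup id = A ↔ (∀ x, x ∈ A ↔ ∃ B ∈ π, x ∈ B) := by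
    constructor
    · rintro rfl x; simp [Finset.mem_sup]
    · intro h; ext x; rw [h]; simp [Finset.mem_sup]
  unfold finsetPartitions
  rw [Finset.mem_filter, hsup]
  constructor
  · exact fun h => h.2
  · intro h
    refine ⟨?_, h⟩
    rw [Finset.mem_powerset]
    intro B hB
    rw [Finset.mem_powerset]
    intro x hx
    exact (h.2.2 x).mpr ⟨B, hB, hx⟩

lemma count_blocks {n : ℕ} {A : Finset (Fin n)} {π : Finset (Finset (Fin n))}
    (h : π ∈ finsetPartitions A) {a : Fin n} (ha : a ∈ A) :
    (π.filter (fun C => a ∉ C)).card = π.card - 1 ∧ 1 ≤ π.card := by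
  rw [mem_parts] at h
  obtain ⟨B, hB, haB⟩ := (h.2.2 a).mp ha
  have : π.filter (fun C => a ∉ C) = π.erase B := by
    ext C
    simp only [Finset.mem_filter, Finset.mem_erase]
    constructor
    · rintro ⟨hC, haC⟩
      exact ⟨fun e => haC (e ▸ haB), hC⟩
    · rintro ⟨hne, hC⟩
      exact ⟨hC, fun haC => Finset.disjoint_left.mp (h.2.1 C hC B hB hne) haC haB⟩
  rw [this, Finset.card_erase_of_mem hB]
  exact ⟨rfl, Finset.card_pos.mpr ⟨B, hB⟩⟩

/-- Abstract cumulants. -/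
noncomputable def kap {n : ℕ} (M : Finset (Fin n) → ℝ) (A : Finset (Fin n)) : ℝ :=
  ∑ π ∈ finsetPartitions A,
    ((π.card - 1).factorial : ℝ) * (-1 : ℝ) ^ (π.card - 1) * ∏ B ∈ π, M B

lemma kap_empty {n : ℕ} (M : Finset (Fin n) → ℝ) : kap M ∅ = 1 := by
  have : finsetPartitions (∅ : Finset (Fin n)) = {∅} := by
    ext π
    rw [mem_parts, Finset.mem_singleton]
    constructor
    · rintro ⟨h1, -, h3⟩
      by_contra hne
      obtain ⟨B, hB⟩ := Finset.nonempty_iff_ne_empty.mpr hne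
      obtain ⟨x, hx⟩ := h1 B hB
      exact absurd ((h3 x).mpr ⟨B, hB, hx⟩) (by simp)
    · rintro rfl; simp
  simp [kap, this]

lemma singleton_mem_parts {n : ℕ} {A : Finset (Fin n)} (hA : A.Nonempty) :
    {A} ∈ finsetPartitions A := by
  rw [mem_parts]
  refine ⟨by simpa using hA, ?_, by simp⟩
  intro B hB C hC hne
  simp at hB hC
  exact absurd (hB.trans hC.symm) hne

lemma kap_bij {n : ℕ} (M : Finset (Fin n) → ℝ) (A : Finset (Fin n)) (a : Fin n) (ha : a ∈ A) :
    ∑ π ∈ finsetPartitions A, ∑ C ∈ π.filter (fun C => a ∉ C),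
      ((π.card - 2).factorial : ℝ) * (-1 : ℝ) ^ (π.card - 2) * ∏ B ∈ π, M B =
    ∑ B ∈ A.powerset.filter (fun B => a ∈ B ∧ B ≠ A), kap M B * M (A \ B) := by
  unfold kap
  simp_rw [Finset.sum_mul]
  rw [Finset.sum_sigma', Finset.sum_sigma']
  refine Finset.sum_bij' (fun p _ => ⟨A \ p.2, p.1.erase p.2⟩)
    (fun q _ => ⟨insert (A \ q.1) q.2, A \ q.1⟩) ?_ ?_ ?_ ?_ ?_
  · rintro ⟨π, C⟩ hp
    simp only [Finset.mem_sigma, Finset.mem_filter, Finset.mem_powerset, mem_parts] at hp ⊢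
    obtain ⟨⟨h1, h2, h3⟩, hC, haC⟩ := hp
    refine ⟨⟨Finset.sdiff_subset, by simp [ha, haC], ?_⟩, ?_, ?_, ?_⟩
    · intro e
      obtain ⟨x, hx⟩ := h1 C hC
      have hxA : x ∈ A := (h3 x).mpr ⟨C, hC, hx⟩
      rw [← e] at hxA
      simp [hx] at hxA
    · intro B hB; exact h1 B (Finset.mem_of_mem_erase hB)
    · intro B hB D hD; exact h2 B (Finset.mem_of_mem_erase hB) D (Finset.mem_of_mem_erase hD)
    · intro x
      rw [Finset.mem_sdiff, h3]
      constructor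
      · rintro ⟨⟨B, hB, hx⟩, hxC⟩
        exact ⟨B, Finset.mem_erase.mpr ⟨fun e => hxC (e ▸ hx), hB⟩, hx⟩
      · rintro ⟨B, hB, hx⟩
        rw [Finset.mem_erase] at hB
        exact ⟨⟨B, hB.2, hx⟩, fun hxC => Finset.disjoint_left.mp (h2 B hB.2 C hC hB.1) hx hxC⟩
  · rintro ⟨B, π⟩ hp
    simp only [Finset.mem_sigma, Finset.mem_filter, Finset.mem_powerset, mem_parts] at hp ⊢
    obtain ⟨⟨hBA, haB, hne⟩, h1, h2, h3⟩ := hp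
    have hd : ∀ D ∈ π, Disjoint D (A \ B) := by
      intro D hD
      rw [Finset.disjoint_left]
      intro x hx hx'
      exact (Finset.mem_sdiff.mp hx').2 ((h3 x).mpr ⟨D, hD, hx⟩)
    refine ⟨⟨?_, ?_, ?_⟩, by simp, by simp [haB]⟩
    · intro D hD
      rw [Finset.mem_insert] at hD
      rcases hD with rfl | hD
      · rw [Finset.sdiff_nonempty]
        exact fun h => hne (Finset.Subset.antisymm hBA h)
      · exact h1 D hD
    · intro D hD E hE hDE
      rw [Finset.mem_insert] at hD hE
      rcases hD with rfl | hD <;> rcases hE with rfl | hE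
      · exact absurd rfl hDE
      · exact (hd E hE).symm
      · exact hd D hD
      · exact h2 D hD E hE hDE
    · intro x
      constructor
      · intro hx
        by_cases hxB : x ∈ B
        · obtain ⟨D, hD, hxD⟩ := (h3 x).mp hxB
          exact ⟨D, Finset.mem_insert_of_mem hD, hxD⟩
        · exact ⟨A \ B, Finset.mem_insert_self _ _, by simp [hx, hxB]⟩
      · rintro ⟨D, hD, hxD⟩
        rw [Finset.mem_insert] at hD
        rcases hD with rfl | hD
        · exact (Finset.mem_sdiff.mp hxD).1
        · exact hBA ((h3 x).mpr ⟨D, hD, hxD⟩)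
  · rintro ⟨π, C⟩ hp
    simp only [Finset.mem_sigma, Finset.mem_filter, mem_parts] at hp
    obtain ⟨⟨h1, h2, h3⟩, hC, haC⟩ := hp
    have hCA : C ⊆ A := fun x hx => (h3 x).mpr ⟨C, hC, hx⟩
    simp only [Finset.sdiff_sdiff_eq_self hCA, Finset.insert_erase hC]
  · rintro ⟨B, π⟩ hp
    simp only [Finset.mem_sigma, Finset.mem_filter, Finset.mem_powerset, mem_parts] at hp
    obtain ⟨⟨hBA, haB, hne⟩, h1, h2, h3⟩ := hp
    have hnot : A \ B ∉ π := by
      intro h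
      obtain ⟨x, hx⟩ := h1 _ h
      exact (Finset.mem_sdiff.mp hx).2 ((h3 x).mpr ⟨_, h, hx⟩)
    simp only [Finset.sdiff_sdiff_eq_self hBA, Finset.erase_insert hnot]
  · rintro ⟨π, C⟩ hp
    simp only [Finset.mem_sigma, Finset.mem_filter, mem_parts] at hp
    obtain ⟨⟨h1, h2, h3⟩, hC, haC⟩ := hp
    have hCA : C ⊆ A := fun x hx => (h3 x).mpr ⟨C, hC, hx⟩
    simp only [Finset.sdiff_sdiff_eq_self hCA, Finset.card_erase_of_mem hC]
    rw [← Finset.mul_prod_erase π M hC, Nat.sub_sub]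
    ring

lemma kap_rec {n : ℕ} (M : Finset (Fin n) → ℝ) (A : Finset (Fin n)) (a : Fin n) (ha : a ∈ A) :
    kap M A = M A - ∑ B ∈ A.powerset.filter (fun B => a ∈ B ∧ B ≠ A), kap M B * M (A \ B) := by
  rw [← kap_bij M A a ha]
  have hA : {A} ∈ finsetPartitions A := singleton_mem_parts ⟨a, ha⟩
  unfold kap
  rw [← Finset.add_sum_erase _ _ hA, ← Finset.add_sum_erase _ (fun π => ∑ C ∈ _, _) hA]
  have h0 : ({A} : Finset (Finset (Fin n))).filter (fun C => a ∉ C) = ∅ := by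
    ext C; simp; rintro rfl; exact ha
  rw [h0, Finset.sum_empty, zero_add, sub_eq_add_neg, ← Finset.sum_neg_distrib]
  congr 1
  · simp
  · refine Finset.sum_congr rfl fun π hπ => ?_
    rw [Finset.mem_erase] at hπ
    obtain ⟨hc, h1⟩ := count_blocks hπ.2 ha
    have h2 : 2 ≤ π.card := by
      by_contra hlt
      have h1' : π.card = 1 := by omega
      obtain ⟨B, rfl⟩ := Finset.card_eq_one.mp h1'
      apply hπ.1
      have := (mem_parts.mp hπ.2).2.2
      congr 1
      ext x; simp [this]
    rw [Finset.sum_const, hc, nsmul_eq_mul]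
    obtain ⟨k, hk⟩ := Nat.exists_eq_add_of_le h2
    rw [hk, show 2 + k - 1 = k + 1 by omega, show 2 + k - 2 = k by omega, Nat.factorial_succ]
    push_cast
    ring

lemma kap_unique {n : ℕ} (M c : Finset (Fin n) → ℝ) (hM : M ∅ = 1) (hc : c ∅ = 1)
    (hrec : ∀ A, ∀ a ∈ A, M A = ∑ B ∈ A.powerset.filter (fun B => a ∈ B), c B * M (A \ B))
    (A : Finset (Fin n)) : kap M A = c A := by
  induction A using Finset.strongInduction with
  | H A ih =>
    rcases A.eq_empty_or_nonempty with rfl | ⟨a, ha⟩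
    · rw [kap_empty, hc]
    · rw [kap_rec M A a ha]
      have h1 := hrec A a ha
      have hmem : A ∈ A.powerset.filter (fun B => a ∈ B) := by simp [ha]
      rw [← Finset.add_sum_erase _ _ hmem, Finset.sdiff_self, hM, mul_one] at h1
      have h2 : (A.powerset.filter (fun B => a ∈ B)).erase A =
          A.powerset.filter (fun B => a ∈ B ∧ B ≠ A) := by
        ext B; simp only [Finset.mem_erase, Finset.mem_filter]; tauto
      rw [h2] at h1
      rw [h1, sub_eq_iff_eq_add]
      congr 1
      refine Finset.sum_congr rfl fun B hB => ?_
      simp only [Finset.mem_filter, Finset.mem_powerset] at hB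
      rw [ih B (Finset.ssubset_iff_subset_ne.mpr ⟨hB.1, hB.2.2⟩)]

/-- permutations fixing the complement of `A`. -/
noncomputable def PA {n : ℕ} (A : Finset (Fin n)) : Finset (Equiv.Perm (Fin n)) :=
  Finset.univ.filter fun σ => ∀ x, x ∉ A → σ x = x

/-- cyclic permutations of `A`. -/
noncomputable def CA {n : ℕ} (A : Finset (Fin n)) : Finset (Equiv.Perm (Fin n)) :=
  (PA A).filter fun σ => ∀ x ∈ A, ∀ y ∈ A, σ.SameCycle x y

lemma mem_PA {n : ℕ} {A : Finset (Fin n)} {σ : Equiv.Perm (Fin n)} :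
    σ ∈ PA A ↔ ∀ x, x ∉ A → σ x = x := by simp [PA]

lemma mem_CA {n : ℕ} {A : Finset (Fin n)} {σ : Equiv.Perm (Fin n)} :
    σ ∈ CA A ↔ (∀ x, x ∉ A → σ x = x) ∧ ∀ x ∈ A, ∀ y ∈ A, σ.SameCycle x y := by
  simp [CA, mem_PA]

lemma PA_maps {n : ℕ} {A : Finset (Fin n)} {σ : Equiv.Perm (Fin n)} (h : σ ∈ PA A) (x : Fin n) :
    σ x ∈ A ↔ x ∈ A := by
  rw [mem_PA] at h
  by_cases hx : x ∈ A
  · simp only [hx, iff_true]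
    by_contra hn
    have := σ.injective (h _ hn)
    exact hn (this.symm ▸ hx)
  · rw [h x hx]

lemma perm_rec {n : ℕ} (G : Fin n → Fin n → ℝ) (ε : Equiv.Perm (Fin n) →* ℝ)
    (A : Finset (Fin n)) (a : Fin n) (ha : a ∈ A) :
    ∑ σ ∈ PA A, ε σ * ∏ i ∈ A, G i (σ i) =
    ∑ B ∈ A.powerset.filter (fun B => a ∈ B),
      (∑ σ ∈ CA B, ε σ * ∏ i ∈ B, G i (σ i)) *
        (∑ σ ∈ PA (A \ B), ε σ * ∏ i ∈ A \ B, G i (σ i)) := by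
  simp_rw [Finset.sum_mul_sum, ← Finset.sum_product']
  rw [Finset.sum_sigma']
  refine Finset.sum_bij' (fun σ _ => ⟨Finset.univ.filter (fun x => σ.SameCycle a x),
      (σ.cycleOf a, (σ.cycleOf a)⁻¹ * σ)⟩) (fun q _ => q.2.1 * q.2.2) ?_ ?_ ?_ ?_ ?_
  · intro σ hσ
    rw [mem_PA] at hσ
    simp only [Finset.mem_sigma, Finset.mem_filter, Finset.mem_powerset, Finset.mem_product,
      mem_PA, mem_CA, Finset.mem_univ, true_and, Finset.mem_sdiff, not_and, not_not]
    refine ⟨⟨?_, Equiv.Perm.SameCycle.refl _ _⟩, ⟨?_, ?_⟩, ?_⟩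
    · intro x hx
      simp only [Finset.mem_filter, Finset.mem_univ, true_and] at hx
      by_contra hxA
      exact hxA ((hx.eq_of_right (hσ x hxA)) ▸ ha)
    · intro x hx
      exact Equiv.Perm.cycleOf_apply_of_not_sameCycle hx
    · have key : ∀ x, σ.SameCycle a x → (σ.cycleOf a).SameCycle a x := by
        rintro x ⟨k, hk⟩
        exact ⟨k, by rw [Equiv.Perm.cycleOf_zpow_apply_self, hk]⟩
      intro x hx y hy
      exact (key x hx).symm.trans (key y hy)
    · intro x hx
      rw [Equiv.Perm.mul_apply, Equiv.Perm.inv_eq_iff_eq]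
      by_cases hs : σ.SameCycle a x
      · rw [hs.cycleOf_apply]
      · rw [Equiv.Perm.cycleOf_apply_of_not_sameCycle hs]
        by_contra hne
        exact hs (hx (by by_contra hxA; exact hne (hσ x hxA)))
  · rintro ⟨B, σ₁, σ₂⟩ hq
    simp only [Finset.mem_sigma, Finset.mem_filter, Finset.mem_powerset, Finset.mem_product,
      mem_PA, mem_CA, Finset.mem_sdiff, not_and, not_not] at hq ⊢
    obtain ⟨⟨hBA, haB⟩, ⟨h1, h2⟩, h3⟩ := hq
    intro x hx
    rw [Equiv.Perm.mul_apply, h3 x (fun h => absurd h hx), h1 x (fun h => hx (hBA h))]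
  · intro σ hσ
    simp
  · rintro ⟨B, σ₁, σ₂⟩ hq
    simp only [Finset.mem_sigma, Finset.mem_filter, Finset.mem_powerset, Finset.mem_product] at hq
    obtain ⟨⟨hBA, haB⟩, h12, h3⟩ := hq
    have h1P : σ₁ ∈ PA B := (Finset.mem_filter.mp h12).1
    obtain ⟨h1, h2⟩ := mem_CA.mp h12
    rw [mem_PA] at h3
    have hB : ∀ x ∈ B, (σ₁ * σ₂) x = σ₁ x := by
      intro x hx
      rw [Equiv.Perm.mul_apply, h3 x (by simp [hx])]
    have hpow : ∀ k : ℕ, ((σ₁ * σ₂) ^ k) a = (σ₁ ^ k) a ∧ (σ₁ ^ k) a ∈ B := by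
      intro k
      induction k with
      | zero => simp [haB]
      | succ k ih =>
        rw [pow_succ', pow_succ', Equiv.Perm.mul_apply, Equiv.Perm.mul_apply σ₁ (σ₁ ^ k), ih.1,
          hB _ ih.2]
        exact ⟨rfl, (PA_maps h1P _).mpr ih.2⟩
    have hsame : ∀ x, (σ₁ * σ₂).SameCycle a x ↔ x ∈ B := by
      intro x
      constructor
      · intro h
        obtain ⟨k, hk⟩ := h.exists_nat_pow_eq
        rw [← hk, (hpow k).1]; exact (hpow k).2
      · intro h
        obtain ⟨k, hk⟩ := (h2 a haB x h).exists_nat_pow_eq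
        refine ⟨k, ?_⟩
        rw [zpow_natCast, (hpow k).1, hk]
    have hcyc : (σ₁ * σ₂).cycleOf a = σ₁ := by
      ext1 x
      by_cases hx : x ∈ B
      · rw [((hsame x).mpr hx).cycleOf_apply, hB x hx]
      · rw [Equiv.Perm.cycleOf_apply_of_not_sameCycle (fun h => hx ((hsame x).mp h)), h1 x hx]
    have hF : Finset.univ.filter (fun x => (σ₁ * σ₂).SameCycle a x) = B := by
      ext x; simp [hsame]
    simp only [hF, hcyc, inv_mul_cancel_left]
  · intro σ hσ
    have hsub : Finset.univ.filter (fun x => σ.SameCycle a x) ⊆ A := by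
      intro x hx
      simp only [Finset.mem_filter, Finset.mem_univ, true_and] at hx
      by_contra hxA
      exact hxA ((hx.eq_of_right (mem_PA.mp hσ x hxA)) ▸ ha)
    simp only
    rw [← Finset.prod_sdiff hsub]
    have e1 : ε σ = ε (σ.cycleOf a) * ε ((σ.cycleOf a)⁻¹ * σ) := by
      rw [← map_mul]; simp
    have e2 : ∏ i ∈ Finset.univ.filter (fun x => σ.SameCycle a x), G i (σ i) =
        ∏ i ∈ Finset.univ.filter (fun x => σ.SameCycle a x), G i (σ.cycleOf a i) := by
      refine Finset.prod_congr rfl fun i hi => ?_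
      simp only [Finset.mem_filter, Finset.mem_univ, true_and] at hi
      rw [hi.cycleOf_apply]
    have e3 : ∏ i ∈ A \ Finset.univ.filter (fun x => σ.SameCycle a x), G i (σ i) =
        ∏ i ∈ A \ Finset.univ.filter (fun x => σ.SameCycle a x),
          G i (((σ.cycleOf a)⁻¹ * σ) i) := by
      refine Finset.prod_congr rfl fun i hi => ?_
      simp only [Finset.mem_sdiff, Finset.mem_filter, Finset.mem_univ, true_and] at hi
      congr 1
      rw [Equiv.Perm.mul_apply, eq_comm, Equiv.Perm.inv_eq_iff_eq,
        Equiv.Perm.cycleOf_apply_of_not_sameCycle]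
      rw [Equiv.Perm.sameCycle_apply_right]; exact hi.2
    rw [e2, e3, e1]
    ring

lemma sum_perm_subtype {n : ℕ} (A : Finset (Fin n)) (f : Equiv.Perm (Fin n) → ℝ) :
    ∑ σ : Equiv.Perm {x // x ∈ A}, f (Equiv.Perm.ofSubtype σ) = ∑ σ ∈ PA A, f σ := by
  refine Finset.sum_bij (fun σ _ => Equiv.Perm.ofSubtype σ) ?_ ?_ ?_ ?_
  · intro σ _
    rw [mem_PA]
    intro x hx
    exact Equiv.Perm.ofSubtype_apply_of_not_mem σ hx
  · intro σ _ τ _ h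
    exact Equiv.Perm.ofSubtype_injective h
  · intro σ hσ
    refine ⟨σ.subtypePerm (PA_maps hσ), Finset.mem_univ _, ?_⟩
    apply Equiv.Perm.ofSubtype_subtypePerm
    intro x hx
    by_contra h
    exact hx (mem_PA.mp hσ x h)
  · intro σ _; rfl

lemma cyc_iff {n : ℕ} (A : Finset (Fin n)) (σ : Equiv.Perm {x // x ∈ A}) :
    (∀ x y, ∃ m : ℕ, (σ ^ m) x = y) ↔
      ∀ x ∈ A, ∀ y ∈ A, (Equiv.Perm.ofSubtype σ).SameCycle x y := by
  have hp : ∀ (m : ℕ) (x : {x // x ∈ A}),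
      ((Equiv.Perm.ofSubtype σ) ^ m) (x : Fin n) = ((σ ^ m) x : {x // x ∈ A}) := by
    intro m x
    rw [← map_pow, Equiv.Perm.ofSubtype_apply_coe]
  constructor
  · intro h x hx y hy
    obtain ⟨m, hm⟩ := h ⟨x, hx⟩ ⟨y, hy⟩
    refine ⟨m, ?_⟩
    rw [zpow_natCast]
    have := hp m ⟨x, hx⟩
    rw [hm] at this
    exact this
  · intro h x y
    obtain ⟨m, hm⟩ := (h x x.2 y y.2).exists_nat_pow_eq
    refine ⟨m, ?_⟩
    rw [hp] at hm
    exact Subtype.ext hm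

lemma sum_cyc_subtype {n : ℕ} (A : Finset (Fin n)) (f : Equiv.Perm (Fin n) → ℝ) :
    ∑ σ ∈ Finset.univ.filter (fun σ : Equiv.Perm {x // x ∈ A} =>
        ∀ x y, ∃ m : ℕ, (σ ^ m) x = y), f (Equiv.Perm.ofSubtype σ) = ∑ σ ∈ CA A, f σ := by
  unfold CA
  rw [Finset.sum_filter, Finset.sum_filter, ← sum_perm_subtype]
  refine Finset.sum_congr rfl fun σ _ => ?_
  simp only [cyc_iff]

lemma kap_perm {n : ℕ} (G : Fin n → Fin n → ℝ) (ε : Equiv.Perm (Fin n) →* ℝ)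
    (A : Finset (Fin n)) :
    kap (fun B => ∑ σ : Equiv.Perm {x // x ∈ B},
      ε (Equiv.Perm.ofSubtype σ) * ∏ i : {x // x ∈ B}, G i (σ i)) A =
    ∑ σ ∈ Finset.univ.filter (fun σ : Equiv.Perm {x // x ∈ A} =>
        ∀ x y, ∃ m : ℕ, (σ ^ m) x = y),
      ε (Equiv.Perm.ofSubtype σ) * ∏ i : {x // x ∈ A}, G i (σ i) := by
  have hw : ∀ (B : Finset (Fin n)) (σ : Equiv.Perm {x // x ∈ B}),
      ε (Equiv.Perm.ofSubtype σ) * ∏ i : {x // x ∈ B}, G i (σ i) =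
      (fun τ : Equiv.Perm (Fin n) => ε τ * ∏ i ∈ B, G i (τ i)) (Equiv.Perm.ofSubtype σ) := by
    intro B σ
    simp only
    rw [← Finset.prod_coe_sort B]
    simp only [Equiv.Perm.ofSubtype_apply_coe]
  simp_rw [hw]
  rw [sum_cyc_subtype A (fun τ : Equiv.Perm (Fin n) => ε τ * ∏ i ∈ A, G i (τ i))]
  have : (fun B : Finset (Fin n) => ∑ σ : Equiv.Perm {x // x ∈ B},
      (fun τ : Equiv.Perm (Fin n) => ε τ * ∏ i ∈ B, G i (τ i)) (Equiv.Perm.ofSubtype σ)) =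
      fun B => ∑ σ ∈ PA B, ε σ * ∏ i ∈ B, G i (σ i) := by
    ext B
    exact sum_perm_subtype B (fun τ : Equiv.Perm (Fin n) => ε τ * ∏ i ∈ B, G i (τ i))
  rw [this]
  have hP0 : PA (∅ : Finset (Fin n)) = {1} := by
    ext σ; rw [mem_PA, Finset.mem_singleton]
    constructor
    · intro h; ext1 x; simpa using h x (by simp)
    · rintro rfl; simp
  have hC0 : CA (∅ : Finset (Fin n)) = {1} := by
    unfold CA; rw [hP0]; simp
  refine kap_unique _ (fun A => ∑ σ ∈ CA A, ε σ * ∏ i ∈ A, G i (σ i)) ?_ ?_ ?_ A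
  · simp [hP0]
  · simp [hC0]
  · intro A a ha
    exact perm_rec G ε A a ha

lemma sign_cyc {n : ℕ} (A : Finset (Fin n)) (σ : Equiv.Perm {x // x ∈ A})
    (h : ∀ x y, ∃ m : ℕ, (σ ^ m) x = y) :
    ((Equiv.Perm.sign σ : ℤ) : ℝ) = (-1 : ℝ) ^ (A.card - 1) := by
  rcases Nat.lt_or_ge A.card 2 with hc | hc
  · have hs : Subsingleton {x // x ∈ A} := by
      rw [← Fintype.card_le_one_iff_subsingleton, Fintype.card_coe]; omega
    have : σ = 1 := by ext1 x; exact Subsingleton.elim _ _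
    rw [this, show A.card - 1 = 0 by omega]; simp
  · have hn : Nontrivial {x // x ∈ A} := by
      rw [← Fintype.one_lt_card_iff_nontrivial, Fintype.card_coe]; omega
    have hmove : ∀ x, σ x ≠ x := by
      intro x hx
      obtain ⟨y, hy⟩ := exists_ne x
      obtain ⟨m, hm⟩ := h x y
      rw [Equiv.Perm.pow_apply_eq_self_of_apply_eq_self hx] at hm
      exact hy hm.symm
    obtain ⟨x, -⟩ := exists_pair_ne {x // x ∈ A}
    have hcyc : σ.IsCycle := by
      refine ⟨x, hmove x, fun y _ => ?_⟩
      obtain ⟨m, hm⟩ := h x y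
      exact ⟨m, by rw [zpow_natCast, hm]⟩
    have hsupp : σ.support = Finset.univ := by
      ext y; simp [hmove y]
    rw [hcyc.sign, hsupp, Finset.card_univ, Fintype.card_coe]
    obtain ⟨k, hk⟩ := Nat.exists_eq_add_of_le hc
    rw [hk, show 2 + k - 1 = k + 1 by omega]
    push_cast
    ring

/-- **Cumulant duality for squares (bosonic vs fermionic)**: the joint cumulant
of `(|Z_i|²)_{i∈A}` equals `(-1)^{|A|-1}` times the fermionic cumulant;
moreover both are sums over cyclic permutations of `A`, and every cyclic
permutation of `A` has sign `(-1)^{|A|-1}`. -/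
theorem cumulant_duality_squares {Ω : Type*} [MeasurableSpace Ω]
    (μ : Measure Ω) [IsProbabilityMeasure μ] {n : ℕ}
    (G : Matrix (Fin n) (Fin n) ℝ) (hGsym : G.IsSymm) (hGpos : G.PosDef)
    (Z : Fin n → Ω → ℂ) (hmZ : ∀ i, Measurable (Z i))
    (hZ : IsCenteredComplexGaussianVector μ Z)
    (hcovZ : ∀ i j, ∫ ω, Z i ω * (starRingEnd ℂ) (Z j ω) ∂μ = (G i j : ℂ))
    (hpseudoZ : ∀ i j, ∫ ω, Z i ω * Z j ω ∂μ = 0)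
    (A : Finset (Fin n)) :
    (kBos μ Z A = (-1 : ℝ) ^ (A.card - 1) * kFerm G A) ∧
    (kBos μ Z A =
      ∑ σ ∈ Finset.univ.filter (fun σ : Equiv.Perm {x // x ∈ A} =>
          ∀ x y, ∃ m : ℕ, (σ ^ m) x = y),
        ∏ i : {x // x ∈ A}, G i (σ i)) ∧
    (kFerm G A =
      ∑ σ ∈ Finset.univ.filter (fun σ : Equiv.Perm {x // x ∈ A} =>
          ∀ x y, ∃ m : ℕ, (σ ^ m) x = y),
        ((Equiv.Perm.sign σ : ℤ) : ℝ) * ∏ i : {x // x ∈ A}, G i (σ i)) ∧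
    (∀ σ : Equiv.Perm {x // x ∈ A}, (∀ x y, ∃ m : ℕ, (σ ^ m) x = y) →
      ((Equiv.Perm.sign σ : ℤ) : ℝ) = (-1 : ℝ) ^ (A.card - 1)) := by
  have hBos : kBos μ Z A =
      ∑ σ ∈ Finset.univ.filter (fun σ : Equiv.Perm {x // x ∈ A} =>
          ∀ x y, ∃ m : ℕ, (σ ^ m) x = y),
        ∏ i : {x // x ∈ A}, G i (σ i) := by
    have h := kap_perm (fun i j => G i j) 1 A
    simp only [MonoidHom.one_apply, one_mul] at h
    rw [← h]
    unfold kBos kap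
    have hmom : ∀ B : Finset (Fin n), ∫ ω, ∏ i ∈ B, Complex.normSq (Z i ω) ∂μ =
        ∑ σ : Equiv.Perm {x // x ∈ B}, ∏ i : {x // x ∈ B}, G i (σ i) := by
      intro B
      rw [← wick_perm (μ := μ) (fun i : {x // x ∈ B} => Z i) (fun i => hmZ i) ?_
        (fun i j => G i j) (fun i j => hcovZ i j) (fun i j => hpseudoZ i j)]
      · congr 1; ext ω
        exact (Finset.prod_coe_sort B (fun i => Complex.normSq (Z i ω))).symm
      · intro c d
        obtain ⟨v, hv⟩ := hZ (fun k => if h : k ∈ B then c ⟨k, h⟩ else 0)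
          (fun k => if h : k ∈ B then d ⟨k, h⟩ else 0)
        refine ⟨v, ?_⟩
        rw [← hv]
        congr 1
        ext ω
        rw [← Finset.sum_subset (Finset.subset_univ B)
          (fun k _ hk => by simp [hk]), ← Finset.sum_coe_sort B]
        refine Finset.sum_congr rfl fun k _ => ?_
        simp
    simp_rw [hmom]
  have hFerm : kFerm G A =
      ∑ σ ∈ Finset.univ.filter (fun σ : Equiv.Perm {x // x ∈ A} =>
          ∀ x y, ∃ m : ℕ, (σ ^ m) x = y),
        ((Equiv.Perm.sign σ : ℤ) : ℝ) * ∏ i : {x // x ∈ A}, G i (σ i) := by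
    have h := kap_perm (fun i j => G i j)
      (((Int.castRingHom ℝ : ℤ →* ℝ).comp (Units.coeHom ℤ)).comp Equiv.Perm.sign) A
    simp only [MonoidHom.comp_apply, Equiv.Perm.sign_ofSubtype, Units.coeHom_apply,
      MonoidHom.coe_coe, eq_intCast] at h
    rw [← h]
    unfold kFerm kap
    have hdet : ∀ B : Finset (Fin n), (G.submatrix (fun a : {x // x ∈ B} => (a : Fin n))
          (fun a : {x // x ∈ B} => (a : Fin n))).det =
        ∑ σ : Equiv.Perm {x // x ∈ B}, ((Equiv.Perm.sign σ : ℤ) : ℝ) *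
          ∏ i : {x // x ∈ B}, G i (σ i) := by
      intro B
      rw [← Matrix.det_transpose, Matrix.det_apply']
      rfl
    simp_rw [hdet]
  refine ⟨?_, hBos, hFerm, sign_cyc A⟩
  rw [hBos, hFerm, Finset.mul_sum]
  refine Finset.sum_congr rfl fun σ hσ => ?_
  rw [sign_cyc A σ (Finset.mem_filter.mp hσ).2, ← mul_assoc, ← mul_pow]
  simp
end
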